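/- Let n ≥ 1, μ > 0, α > 0, γ ≥ 0, χ > 0, t > 0, let m ≥ 1 be an integer and 0 < κ with mκ < n, and set K(n,κ) := Γ((n−κ)/2)/(2^κ π^{n/2} Γ(κ/2)). Let L : (0,∞) → (0,∞) be slowly varying at infinity and bounded on each finite interval, and let f : ℝⁿ → [0,∞) be measurable, integrable, decreasing in |λ| for |λ| > λ₀ (some λ₀ > 0), continuous at every λ ≠ 0, and satisfying f(λ)·|λ|^{n−κ}/(K(n,κ)·L(1/|λ|)) → 1 as λ → 0. For ε > 0 define M_ε : ℝ^{n·m} → [0,∞) by M_ε(λ₁,…,λ_m) := ε^{χ m (n−κ)/2}·L^{−m/2}(ε^{−χ})·exp(−μ t (ε^{2/(α+γ)}+|λ₁+⋯+λ_m|²)^{γ/2} |λ₁+⋯+λ_m|^{α})·∏_{σ=1}^{m} √(f(ε^{χ} λ_σ)), and define M₀(λ₁,…,λ_m) := K(n,κ)^{m/2}·e^{−μ t |λ₁+⋯+λ_m|^{α+γ}}·∏_{σ=1}^{m} |λ_σ|^{(κ−n)/2}. Then lim_{ε→0⁺} ∫_{ℝ^{n·m}} | M_ε(λ) − M₀(λ)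 |² dλ₁⋯dλ_m = 0. -/

import Mathlib

open MeasureTheory Filter Topology

/-- The Tauberian constant `K(n,c) = Γ((n−c)/2)/(2^c π^{n/2} Γ(c/2))`. -/
noncomputable def tauberK (n : ℕ) (c : ℝ) : ℝ :=
  Real.Gamma (((n : ℝ) - c) / 2) /
    ((2 : ℝ) ^ c * Real.pi ^ ((n : ℝ) / 2) * Real.Gamma (c / 2))

/-- `L` is slowly varying at infinity: `L(cy)/L(y) → 1` as `y → ∞`, uniformly
for `c` in compact subintervals of `(0,∞)`. -/
def SlowlyVaryingAtTop (L : ℝ → ℝ) : Prop :=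
  ∀ a b : ℝ, 0 < a → a < b →
    TendstoUniformlyOn (fun y c => L (c * y) / L y) (fun _ => 1) atTop (Set.Icc a b)

lemma sq_rpow_half {s p : ℝ} (hs : 0 ≤ s) : (s ^ 2) ^ (p / 2) = s ^ p := by
  rw [← Real.rpow_natCast, ← Real.rpow_mul hs, Nat.cast_ofNat, mul_div_cancel₀ _ two_ne_zero]

lemma tauberK_pos {n : ℕ} {c : ℝ} (hc : 0 < c) (hcn : c < n) : 0 < tauberK n c := by
  have h1 := Real.Gamma_pos_of_pos (half_pos (sub_pos.2 hcn))
  have h2 := Real.Gamma_pos_of_pos (half_pos hc)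
  unfold tauberK
  positivity

lemma SlowlyVaryingAtTop.tendsto_div {L : ℝ → ℝ} (hL : SlowlyVaryingAtTop L) {c : ℝ}
    (hc : 0 < c) : Tendsto (fun y => L (c * y) / L y) atTop (𝓝 1) :=
  (hL c (c + 1) hc (by linarith)).tendsto_at (x := c) ⟨le_rfl, by linarith⟩

/-- Potter's bounds. -/
lemma SlowlyVaryingAtTop.exists_potter {L : ℝ → ℝ} (hL : SlowlyVaryingAtTop L)
    (hLpos : ∀ y > 0, 0 < L y) {η : ℝ} (hη : 0 < η) :
    ∃ Y : ℝ, 1 ≤ Y ∧ ∀ y z, Y ≤ y → y ≤ z →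
      L z ≤ 2 ^ η * (z / y) ^ η * L y ∧ L y ≤ 2 ^ η * (z / y) ^ η * L z := by
  have hA : (1 : ℝ) < 2 ^ η := Real.one_lt_rpow (by norm_num) hη
  set A : ℝ := 2 ^ η with hAdef
  have hA0 : 0 < A := by linarith
  have hδ : 0 < 1 - A⁻¹ := sub_pos.2 (inv_lt_one_of_one_lt₀ hA)
  obtain ⟨Y₀, hY₀⟩ := eventually_atTop.1
    (Metric.tendstoUniformlyOn_iff.1 (hL 1 2 one_pos one_lt_two) _ hδ)
  have hstep : ∀ y, max Y₀ 1 ≤ y → ∀ c ∈ Set.Icc (1 : ℝ) 2,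
      L (c * y) ≤ A * L y ∧ L y ≤ A * L (c * y) := by
    intro y hy c hc
    have hy0 : 0 < y := by linarith [le_max_right Y₀ 1]
    have h := hY₀ y ((le_max_left _ _).trans hy) c hc
    rw [Real.dist_eq, abs_lt] at h
    have hLy := hLpos y hy0
    have hAA : A * A⁻¹ = 1 := mul_inv_cancel₀ hA0.ne'
    have hAi : 0 < A⁻¹ := inv_pos.2 hA0
    constructor
    · have : L (c * y) / L y ≤ A := by nlinarith
      rwa [div_le_iff₀ hLy] at this
    · have : A⁻¹ ≤ L (c * y) / L y := by linarith
      rw [le_div_iff₀ hLy] at this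
      calc L y = A * (A⁻¹ * L y) := by rw [← mul_assoc, hAA, one_mul]
        _ ≤ _ := by gcongr
  have hiter : ∀ k : ℕ, ∀ y, max Y₀ 1 ≤ y → ∀ c, 1 ≤ c → c ≤ 2 ^ k →
      L (c * y) ≤ A * c ^ η * L y ∧ L y ≤ A * c ^ η * L (c * y) := by
    intro k
    induction k with
    | zero =>
      intro y hy c hc1 hc2
      have hc : c = 1 := le_antisymm (by simpa using hc2) hc1
      have hy0 : 0 < y := by linarith [le_max_right Y₀ 1]
      have hLy := hLpos y hy0
      subst hc
      simp only [one_mul, Real.one_rpow, mul_one, and_self]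
      nlinarith
    | succ k ih =>
      intro y hy c hc1 hc2
      have hy0 : 0 < y := by linarith [le_max_right Y₀ 1]
      have hLc := hLpos (c * y) (by positivity)
      have hLy := hLpos y hy0
      have hcη : 1 ≤ c ^ η := Real.one_le_rpow hc1 hη.le
      rcases le_total c 2 with hc | hc
      · obtain ⟨h1, h2⟩ := hstep y hy c ⟨hc1, hc⟩
        refine ⟨h1.trans ?_, h2.trans ?_⟩
        · gcongr
          exact le_mul_of_one_le_right hA0.le hcη
        · gcongr
          exact le_mul_of_one_le_right hA0.le hcη
      · obtain ⟨h1, h2⟩ := ih y hy (c / 2) (by linarith) (by rw [pow_succ] at hc2; linarith)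
        obtain ⟨h3, h4⟩ := hstep (c / 2 * y) (by nlinarith) 2 ⟨by norm_num, le_rfl⟩
        have e1 : 2 * (c / 2 * y) = c * y := by ring
        have e2 : A * (c / 2) ^ η = c ^ η := by
          rw [Real.div_rpow (by linarith) (by norm_num), hAdef]
          field_simp
        rw [e1] at h3 h4
        rw [e2] at h1 h2
        constructor
        · calc _ ≤ A * L (c / 2 * y) := h3
            _ ≤ A * (c ^ η * L y) := by gcongr
            _ = _ := by ring
        · calc _ ≤ c ^ η * L (c / 2 * y) := h2
            _ ≤ c ^ η * (A * L (c * y)) := by gcongr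
            _ = _ := by ring
  refine ⟨max Y₀ 1, le_max_right _ _, fun y z hy hz => ?_⟩
  have hy0 : 0 < y := by linarith [le_max_right Y₀ 1]
  obtain ⟨k, hk⟩ := pow_unbounded_of_one_lt (z / y) (one_lt_two (α := ℝ))
  have h := hiter k y hy (z / y) ((one_le_div hy0).2 hz) hk.le
  rwa [div_mul_cancel₀ z hy0.ne'] at h

/-- Uniform domination of the rescaled spectral density. -/
lemma exists_rescaled_density_le {E : Type*} [NormedAddCommGroup E] [NormedSpace ℝ E]
    {f : E → ℝ} {L : ℝ → ℝ} {K κ η d : ℝ}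
    (hL : SlowlyVaryingAtTop L) (hLpos : ∀ y > 0, 0 < L y) (hK : 0 < K) (hκ : 0 ≤ κ)
    (hη : 0 < η)
    (htail : ∀ r > 0, ∃ C : ℝ, 0 ≤ C ∧ ∀ x : E, r ≤ ‖x‖ → f x ≤ C * ‖x‖ ^ (-d))
    (hasymp : Tendsto (fun x : E => f x * ‖x‖ ^ (d - κ) / (K * L (1 / ‖x‖))) (𝓝[≠] 0) (𝓝 1)) :
    ∃ C : ℝ, 0 ≤ C ∧ ∀ᶠ δ in 𝓝[>] (0 : ℝ), ∀ x : E, x ≠ 0 →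
      δ ^ (d - κ) * f (δ • x) / L δ⁻¹ ≤ C * (‖x‖ ^ (κ - η - d) + ‖x‖ ^ (κ + η - d)) := by
  obtain ⟨Y, hY1, hY⟩ := hL.exists_potter hLpos hη
  have hY0 : 0 < Y := by linarith
  obtain ⟨r₁, hr₁, h₁⟩ : ∃ r > 0, ∀ x : E, x ≠ 0 → ‖x‖ < r →
      f x * ‖x‖ ^ (d - κ) / (K * L (1 / ‖x‖)) < 2 := by
    have h := hasymp.eventually (gt_mem_nhds (one_lt_two (α := ℝ)))
    rw [eventually_nhdsWithin_iff, Metric.eventually_nhds_iff] at h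
    obtain ⟨r, hr, h⟩ := h
    exact ⟨r, hr, fun x hx hxr => h (by simpa using hxr) hx⟩
  set r₀ : ℝ := min r₁ Y⁻¹ with hr₀
  have hr₀pos : 0 < r₀ := lt_min hr₁ (inv_pos.2 hY0)
  obtain ⟨C₂, hC₂, h₂⟩ := htail r₀ hr₀pos
  have hLY := hLpos Y hY0
  set A : ℝ := 2 ^ η with hA
  have hA0 : 0 < A := by positivity
  set C₃ : ℝ := C₂ * (A * Y ^ (-η) / L Y) * r₀ ^ (-(κ + η)) with hC₃
  have hC₃nn : 0 ≤ C₃ := by positivity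
  refine ⟨2 * K * A + C₃, by positivity, ?_⟩
  filter_upwards [Ioo_mem_nhdsGT hr₀pos] with δ hδ x hx
  obtain ⟨hδ0, hδr⟩ := hδ
  have hx0 : 0 < ‖x‖ := norm_pos_iff.2 hx
  have hδY : Y ≤ δ⁻¹ := by
    rw [le_inv_comm₀ hY0 hδ0]
    exact hδr.le.trans (min_le_right _ _)
  have hLδ := hLpos δ⁻¹ (inv_pos.2 hδ0)
  have hnorm : ‖δ • x‖ = δ * ‖x‖ := by rw [norm_smul, Real.norm_of_nonneg hδ0.le]
  have p1 : 0 < ‖x‖ ^ (κ - η - d) := by positivity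
  have p2 : 0 < ‖x‖ ^ (κ + η - d) := by positivity
  rw [div_le_iff₀ hLδ]
  rcases lt_or_ge (δ * ‖x‖) r₀ with h | h
  · have hz := hLpos (1 / (δ * ‖x‖)) (by positivity)
    have hzY : Y ≤ 1 / (δ * ‖x‖) := by
      rw [le_one_div hY0 (by positivity), one_div]
      exact h.le.trans (min_le_right _ _)
    have hf := h₁ (δ • x) (smul_ne_zero hδ0.ne' hx) (by
      rw [hnorm]; exact h.trans_le (min_le_left _ _))
    rw [hnorm, div_lt_iff₀ (by positivity), Real.mul_rpow hδ0.le hx0.le] at hf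
    have hf' : δ ^ (d - κ) * f (δ • x) ≤ 2 * K * ‖x‖ ^ (κ - d) * L (1 / (δ * ‖x‖)) := by
      have e : ‖x‖ ^ (d - κ) * ‖x‖ ^ (κ - d) = 1 := by
        rw [← Real.rpow_add hx0]; simp
      calc _ = f (δ • x) * (δ ^ (d - κ) * ‖x‖ ^ (d - κ)) * ‖x‖ ^ (κ - d) := by
            rw [mul_assoc (f _), mul_assoc (δ ^ _), e]; ring
        _ ≤ 2 * (K * L (1 / (δ * ‖x‖))) * ‖x‖ ^ (κ - d) := by gcongr
        _ = _ := by ring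
    have hratio : L (1 / (δ * ‖x‖)) ≤ A * (‖x‖ ^ (-η) + ‖x‖ ^ η) * L δ⁻¹ := by
      have q1 : 0 < ‖x‖ ^ (-η) := by positivity
      have q2 : 0 < ‖x‖ ^ η := by positivity
      rcases le_total ‖x‖ 1 with hx1 | hx1
      · have hle : δ⁻¹ ≤ 1 / (δ * ‖x‖) := by
          rw [← one_div]
          exact one_div_le_one_div_of_le (by positivity) (mul_le_of_le_one_right hδ0.le hx1)
        have := (hY _ _ hδY hle).1
        have e : 1 / (δ * ‖x‖) / δ⁻¹ = ‖x‖⁻¹ := by field_simp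
        rw [e, Real.inv_rpow hx0.le, ← Real.rpow_neg hx0.le] at this
        refine this.trans ?_
        gcongr
        linarith
      · have hle : 1 / (δ * ‖x‖) ≤ δ⁻¹ := by
          rw [← one_div]
          exact one_div_le_one_div_of_le hδ0 (le_mul_of_one_le_right hδ0.le hx1)
        have := (hY _ _ hzY hle).2
        have e : δ⁻¹ / (1 / (δ * ‖x‖)) = ‖x‖ := by field_simp
        rw [e] at this
        refine this.trans ?_
        gcongr
        linarith
    have e1 : ‖x‖ ^ (κ - η - d) = ‖x‖ ^ (κ - d) * ‖x‖ ^ (-η) := by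
      rw [← Real.rpow_add hx0]; ring_nf
    have e2 : ‖x‖ ^ (κ + η - d) = ‖x‖ ^ (κ - d) * ‖x‖ ^ η := by
      rw [← Real.rpow_add hx0]; ring_nf
    calc _ ≤ 2 * K * ‖x‖ ^ (κ - d) * L (1 / (δ * ‖x‖)) := hf'
      _ ≤ 2 * K * ‖x‖ ^ (κ - d) * (A * (‖x‖ ^ (-η) + ‖x‖ ^ η) * L δ⁻¹) := by gcongr
      _ = 2 * K * A * (‖x‖ ^ (κ - η - d) + ‖x‖ ^ (κ + η - d)) * L δ⁻¹ := by rw [e1, e2]; ring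
      _ ≤ _ := by
        gcongr
        linarith
  · have hf := h₂ (δ • x) (by rwa [hnorm])
    rw [hnorm, Real.mul_rpow hδ0.le hx0.le] at hf
    have hLlow : 1 ≤ A * Y ^ (-η) / L Y * δ ^ (-η) * L δ⁻¹ := by
      have := (hY Y δ⁻¹ le_rfl hδY).2
      rw [Real.div_rpow (by positivity) hY0.le, Real.inv_rpow hδ0.le, ← Real.rpow_neg hδ0.le,
        div_eq_mul_inv, ← Real.rpow_neg hY0.le] at this
      calc 1 = L Y / L Y := (div_self hLY.ne').symm
        _ ≤ (A * (δ ^ (-η) * Y ^ (-η)) * L δ⁻¹) / L Y := by gcongr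
        _ = _ := by ring
    have hδle : δ ^ (-(κ + η)) ≤ r₀ ^ (-(κ + η)) * ‖x‖ ^ (κ + η) := by
      have e : (r₀ / ‖x‖) ^ (-(κ + η)) = r₀ ^ (-(κ + η)) * ‖x‖ ^ (κ + η) := by
        rw [Real.div_rpow hr₀pos.le hx0.le, div_eq_mul_inv, ← Real.rpow_neg hx0.le, neg_neg]
      rw [← e]
      exact Real.rpow_le_rpow_of_nonpos (by positivity) ((div_le_iff₀ hx0).2 h) (by linarith)
    have e3 : δ ^ (d - κ) * δ ^ (-d) * δ ^ (-η) = δ ^ (-(κ + η)) := by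
      rw [← Real.rpow_add hδ0, ← Real.rpow_add hδ0]; ring_nf
    have e4 : ‖x‖ ^ (κ + η - d) = ‖x‖ ^ (κ + η) * ‖x‖ ^ (-d) := by
      rw [← Real.rpow_add hx0]; ring_nf
    calc _ ≤ δ ^ (d - κ) * (C₂ * (δ ^ (-d) * ‖x‖ ^ (-d))) * 1 := by rw [mul_one]; gcongr
      _ ≤ δ ^ (d - κ) * (C₂ * (δ ^ (-d) * ‖x‖ ^ (-d))) *
          (A * Y ^ (-η) / L Y * δ ^ (-η) * L δ⁻¹) := by gcongr
      _ = C₂ * (A * Y ^ (-η) / L Y) * (δ ^ (d - κ) * δ ^ (-d) * δ ^ (-η)) * ‖x‖ ^ (-d) *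
          L δ⁻¹ := by ring
      _ ≤ C₂ * (A * Y ^ (-η) / L Y) * (r₀ ^ (-(κ + η)) * ‖x‖ ^ (κ + η)) * ‖x‖ ^ (-d) *
          L δ⁻¹ := by rw [e3]; gcongr
      _ = C₃ * ‖x‖ ^ (κ + η - d) * L δ⁻¹ := by rw [e4]; ring
      _ ≤ _ := by
        gcongr ?_ * _
        have : 0 ≤ 2 * K * A := by positivity
        nlinarith [mul_nonneg this p1.le, mul_nonneg this p2.le, mul_nonneg hC₃nn p1.le]

lemma tendsto_rescaled_density {E : Type*} [NormedAddCommGroup E] [NormedSpace ℝ E]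
    {f : E → ℝ} {L : ℝ → ℝ} {K κ d : ℝ}
    (hL : SlowlyVaryingAtTop L) (hLpos : ∀ y > 0, 0 < L y) (hK : 0 < K)
    (hasymp : Tendsto (fun x : E => f x * ‖x‖ ^ (d - κ) / (K * L (1 / ‖x‖))) (𝓝[≠] 0) (𝓝 1))
    {x : E} (hx : x ≠ 0) :
    Tendsto (fun δ : ℝ => δ ^ (d - κ) * f (δ • x) / L δ⁻¹) (𝓝[>] 0) (𝓝 (K * ‖x‖ ^ (κ - d))) := by
  have hx0 : 0 < ‖x‖ := norm_pos_iff.2 hx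
  have h1 : Tendsto (fun δ : ℝ => δ • x) (𝓝[>] 0) (𝓝[≠] 0) := by
    refine tendsto_nhdsWithin_iff.2 ⟨?_, ?_⟩
    · exact ((by fun_prop : Continuous fun δ : ℝ => δ • x).tendsto' 0 0
        (zero_smul ℝ x)).mono_left nhdsWithin_le_nhds
    · filter_upwards [self_mem_nhdsWithin] with δ hδ
      exact smul_ne_zero (ne_of_gt hδ) hx
  have h2 := (hL.tendsto_div (inv_pos.2 hx0)).comp (tendsto_inv_nhdsGT_zero (𝕜 := ℝ))
  have h3 := ((hasymp.comp h1).mul h2).mul_const (K * ‖x‖ ^ (κ - d))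
  rw [one_mul, one_mul] at h3
  refine h3.congr' ?_
  filter_upwards [self_mem_nhdsWithin] with δ (hδ : 0 < δ)
  have hLδ := hLpos δ⁻¹ (inv_pos.2 hδ)
  have hz := hLpos (‖x‖⁻¹ * δ⁻¹) (by positivity)
  have hnorm : ‖δ • x‖ = δ * ‖x‖ := by rw [norm_smul, Real.norm_of_nonneg hδ.le]
  have e : ‖x‖ ^ (d - κ) * ‖x‖ ^ (κ - d) = 1 := by
    rw [← Real.rpow_add hx0]; simp
  have e1 : 1 / (δ * ‖x‖) = ‖x‖⁻¹ * δ⁻¹ := by field_simp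
  simp only [Function.comp, hnorm, e1]
  rw [Real.mul_rpow hδ.le hx0.le]
  generalize L (‖x‖⁻¹ * δ⁻¹) = z at hz ⊢
  calc _ = δ ^ (d - κ) * f (δ • x) * (‖x‖ ^ (d - κ) * ‖x‖ ^ (κ - d)) / L δ⁻¹ := by
        field_simp
    _ = _ := by rw [e, mul_one]

lemma exists_exp_neg_mul_rpow_le {c p d : ℝ} (hc : 0 < c) (hp : 0 < p) (hd : 0 < d) :
    ∃ C : ℝ, 0 ≤ C ∧ ∀ s : ℝ, 0 ≤ s → Real.exp (-(c * s ^ p)) ≤ C * (1 + s) ^ (-d) := by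
  set q := d / p with hq
  have hq0 : 0 < q := by positivity
  refine ⟨2 ^ d * (1 + (q / c) ^ q), by positivity, fun s hs => ?_⟩
  rw [Real.exp_neg, Real.rpow_neg (by positivity), ← div_eq_mul_inv, le_div_iff₀ (by positivity),
    inv_mul_le_iff₀ (Real.exp_pos _)]
  have hx : 0 ≤ s ^ p := by positivity
  have h1 : s ^ d ≤ (q / c) ^ q * Real.exp (c * s ^ p) := by
    have e : s ^ d = (s ^ p) ^ q := by
      rw [← Real.rpow_mul hs, hq, mul_div_cancel₀ _ hp.ne']
    have h : s ^ p ≤ q / c * Real.exp (c * s ^ p / q) := by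
      have := Real.add_one_le_exp (c * s ^ p / q)
      calc s ^ p = q / c * (c * s ^ p / q) := by field_simp
        _ ≤ _ := by gcongr; linarith
    calc s ^ d = (s ^ p) ^ q := e
      _ ≤ (q / c * Real.exp (c * s ^ p / q)) ^ q := by gcongr
      _ = _ := by
        rw [Real.mul_rpow (by positivity) (by positivity), ← Real.exp_mul,
          div_mul_cancel₀ _ hq0.ne']
  have h2 : (1 + s) ^ d ≤ 2 ^ d * (1 + s ^ d) := by
    rcases le_total s 1 with h | h
    · calc (1 + s) ^ d ≤ 2 ^ d := by gcongr; linarith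
        _ ≤ _ := le_mul_of_one_le_right (by positivity) (by linarith [Real.rpow_nonneg hs d])
    · calc (1 + s) ^ d ≤ (2 * s) ^ d := by gcongr; linarith
        _ = 2 ^ d * s ^ d := Real.mul_rpow (by norm_num) hs
        _ ≤ _ := by gcongr; linarith
  have h3 : 1 ≤ Real.exp (c * s ^ p) := Real.one_le_exp (by positivity)
  calc (1 + s) ^ d ≤ 2 ^ d * (1 + s ^ d) := h2
    _ ≤ 2 ^ d * (Real.exp (c * s ^ p) + (q / c) ^ q * Real.exp (c * s ^ p)) := by gcongr
    _ = _ := by ring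

lemma rpow_neg_mul_rpow_neg_le {x y r s : ℝ} (hx : 0 < x) (hy : 0 < y) (hr : 0 ≤ r)
    (hs : 0 ≤ s) : x ^ (-r) * y ^ (-s) ≤ x ^ (-(r + s)) + y ^ (-(r + s)) := by
  rcases le_total x y with h | h
  · have h1 : y ^ (-s) ≤ x ^ (-s) := Real.rpow_le_rpow_of_nonpos hx h (by linarith)
    have h2 : x ^ (-(r + s)) = x ^ (-r) * x ^ (-s) := by rw [← Real.rpow_add hx]; ring_nf
    have h3 : 0 ≤ y ^ (-(r + s)) := by positivity
    have h4 : x ^ (-r) * y ^ (-s) ≤ x ^ (-r) * x ^ (-s) := by gcongr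
    linarith
  · have h1 : x ^ (-r) ≤ y ^ (-r) := Real.rpow_le_rpow_of_nonpos hy h (by linarith)
    have h2 : y ^ (-(r + s)) = y ^ (-r) * y ^ (-s) := by rw [← Real.rpow_add hy]; ring_nf
    have h3 : 0 ≤ x ^ (-(r + s)) := by positivity
    have h4 : x ^ (-r) * y ^ (-s) ≤ y ^ (-r) * y ^ (-s) := by gcongr
    linarith

lemma one_add_norm_rpow_le {E : Type*} [NormedAddCommGroup E] {d : ℝ} (hd : 0 ≤ d) (u x : E) :
    (1 + ‖u‖) ^ d ≤ 2 ^ d * ((1 + ‖u + x‖) ^ d + ‖x‖ ^ d) := by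
  have h0 : ‖u‖ ≤ ‖u + x‖ + ‖x‖ := by simpa using norm_sub_le (u + x) x
  have h1 : 1 + ‖u‖ ≤ 2 * max (1 + ‖u + x‖) ‖x‖ := by
    have := le_max_left (1 + ‖u + x‖) ‖x‖
    have := le_max_right (1 + ‖u + x‖) ‖x‖
    linarith
  calc (1 + ‖u‖) ^ d ≤ (2 * max (1 + ‖u + x‖) ‖x‖) ^ d := by gcongr
    _ = 2 ^ d * (max (1 + ‖u + x‖) ‖x‖) ^ d :=
      Real.mul_rpow (by norm_num) (le_max_of_le_right (norm_nonneg _))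
    _ ≤ _ := by
      gcongr
      have : 0 ≤ ‖x‖ ^ d := by positivity
      have : 0 ≤ (1 + ‖u + x‖) ^ d := by positivity
      rcases max_choice (1 + ‖u + x‖) ‖x‖ with h | h <;> rw [h] <;> linarith

section
variable {E : Type*} [NormedAddCommGroup E] [NormedSpace ℝ E] [FiniteDimensional ℝ E]
  [MeasureSpace E] [BorelSpace E] [(volume : Measure E).IsAddHaarMeasure]

open Module

lemma integrableOn_ball_norm_rpow [Nontrivial E] {a : ℝ} (ha : 0 < a) :
    IntegrableOn (fun x : E => ‖x‖ ^ (a - finrank ℝ E)) (Metric.ball 0 1) := by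
  rw [integrableOn_fun_norm_addHaar volume (f := fun y : ℝ => y ^ (a - finrank ℝ E))]
  have h1 : IntegrableOn (fun y : ℝ => y ^ (a - 1)) (Set.Ioo 0 1) :=
    (intervalIntegral.integrableOn_Ioo_rpow_iff one_pos).2 (by linarith)
  refine h1.congr_fun (fun y hy => ?_) measurableSet_Ioo
  have hd : 1 ≤ finrank ℝ E := Module.finrank_pos
  simp only [smul_eq_mul]
  rw [← Real.rpow_natCast, ← Real.rpow_add hy.1, Nat.cast_sub hd]
  congr 1
  push_cast
  ring

lemma exists_lintegral_one_add_norm_mul_norm_rpow_le [Nontrivial E] {a r : ℝ} (ha : 0 < a)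
    (har : a < r) (had : a ≤ finrank ℝ E) :
    ∃ C : ℝ, 0 ≤ C ∧ ∀ u : E,
      ∫⁻ x : E, ENNReal.ofReal ((1 + ‖u + x‖) ^ (-r) * ‖x‖ ^ (a - finrank ℝ E)) ≤
        ENNReal.ofReal C := by
  set d : ℝ := (finrank ℝ E : ℝ) with hd
  set q : ℝ := r + (d - a) with hq
  set J : ENNReal := ∫⁻ x : E, ENNReal.ofReal ((1 + ‖x‖) ^ (-q)) with hJ
  have hJfin : J < ⊤ := finite_integral_one_add_norm (by linarith)
  set I : ENNReal := ∫⁻ x in Metric.ball (0 : E) 1, ENNReal.ofReal (‖x‖ ^ (a - d)) with hI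
  have hIfin : I < ⊤ := (integrableOn_ball_norm_rpow ha).lintegral_lt_top
  set T : ENNReal := I + ENNReal.ofReal (2 ^ (d - a)) * (J + J) with hT
  have hTfin : T ≠ ⊤ := by
    rw [hT]
    exact ENNReal.add_ne_top.2 ⟨hIfin.ne, ENNReal.mul_ne_top ENNReal.ofReal_ne_top
      (ENNReal.add_ne_top.2 ⟨hJfin.ne, hJfin.ne⟩)⟩
  refine ⟨T.toReal, ENNReal.toReal_nonneg, fun u => ?_⟩
  rw [ENNReal.ofReal_toReal hTfin]
  have key : ∀ x : E, ENNReal.ofReal ((1 + ‖u + x‖) ^ (-r) * ‖x‖ ^ (a - d)) ≤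
      (Metric.ball (0 : E) 1).indicator (fun x => ENNReal.ofReal (‖x‖ ^ (a - d))) x +
      ENNReal.ofReal (2 ^ (d - a)) * (ENNReal.ofReal ((1 + ‖u + x‖) ^ (-q)) +
        ENNReal.ofReal ((1 + ‖x‖) ^ (-q))) := by
    intro x
    by_cases hx : x ∈ Metric.ball (0 : E) 1
    · rw [Set.indicator_of_mem hx]
      refine le_trans (ENNReal.ofReal_le_ofReal ?_) le_self_add
      refine mul_le_of_le_one_left (by positivity) ?_
      exact Real.rpow_le_one_of_one_le_of_nonpos (by linarith [norm_nonneg (u + x)]) (by linarith)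
    · rw [Set.indicator_of_notMem hx, zero_add, ← ENNReal.ofReal_add (by positivity)
        (by positivity), ← ENNReal.ofReal_mul (by positivity)]
      refine ENNReal.ofReal_le_ofReal ?_
      have hx1 : 1 ≤ ‖x‖ := by simpa using hx
      have h1 : ‖x‖ ^ (a - d) ≤ 2 ^ (d - a) * (1 + ‖x‖) ^ (-(d - a)) := by
        have : ((1 + ‖x‖) / 2) ^ (-(d - a)) = 2 ^ (d - a) * (1 + ‖x‖) ^ (-(d - a)) := by
          rw [Real.div_rpow (by positivity) (by norm_num), Real.rpow_neg (by norm_num : (0:ℝ) ≤ 2)]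
          rw [div_inv_eq_mul, mul_comm]
        rw [← this, neg_sub]
        exact Real.rpow_le_rpow_of_nonpos (by positivity) (by linarith) (by linarith)
      calc (1 + ‖u + x‖) ^ (-r) * ‖x‖ ^ (a - d)
          ≤ (1 + ‖u + x‖) ^ (-r) * (2 ^ (d - a) * (1 + ‖x‖) ^ (-(d - a))) := by gcongr
        _ = 2 ^ (d - a) * ((1 + ‖u + x‖) ^ (-r) * (1 + ‖x‖) ^ (-(d - a))) := by ring
        _ ≤ _ := by
          gcongr
          exact rpow_neg_mul_rpow_neg_le (by positivity) (by positivity) (by linarith)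
            (by linarith)
  refine (lintegral_mono key).trans ?_
  rw [lintegral_add_left ((by fun_prop : Measurable _).indicator measurableSet_ball),
    lintegral_indicator measurableSet_ball, lintegral_const_mul _ (by fun_prop),
    lintegral_add_left (by fun_prop),
    lintegral_add_left_eq_self (fun x : E => ENNReal.ofReal ((1 + ‖x‖) ^ (-q))) u]

lemma exists_lintegral_one_add_norm_mul_norm_rpow_decay [Nontrivial E] {a r d : ℝ} (ha : 0 < a)
    (har : a < r) (hrd : r ≤ d) (hd : d ≤ finrank ℝ E) :
    ∃ C : ℝ, 0 ≤ C ∧ ∀ u : E,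
      ∫⁻ x : E, ENNReal.ofReal ((1 + ‖u + x‖) ^ (-d) * ‖x‖ ^ (a - finrank ℝ E)) ≤
        ENNReal.ofReal (C * (1 + ‖u‖) ^ (-(d - r))) := by
  obtain ⟨C₁, hC₁, h₁⟩ := exists_lintegral_one_add_norm_mul_norm_rpow_le (E := E) ha har
    (by linarith)
  obtain ⟨C₂, hC₂, h₂⟩ := exists_lintegral_one_add_norm_mul_norm_rpow_le (E := E)
    (a := a + (d - r)) (r := d) (by linarith) (by linarith) (by linarith)
  refine ⟨2 ^ (d - r) * (C₁ + C₂), by positivity, fun u => ?_⟩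
  have key : ∀ x : E, x ≠ 0 → (1 + ‖u + x‖) ^ (-d) * ‖x‖ ^ (a - finrank ℝ E) ≤
      (2 ^ (d - r) * (1 + ‖u‖) ^ (-(d - r))) *
        ((1 + ‖u + x‖) ^ (-r) * ‖x‖ ^ (a - finrank ℝ E) +
          (1 + ‖u + x‖) ^ (-d) * ‖x‖ ^ (a + (d - r) - finrank ℝ E)) := by
    intro x hx
    have hx' : 0 < ‖x‖ := norm_pos_iff.2 hx
    have h := one_add_norm_rpow_le (sub_nonneg.2 hrd) u x
    have e1 : (1 + ‖u + x‖) ^ (-r) = (1 + ‖u + x‖) ^ (-d) * (1 + ‖u + x‖) ^ (d - r) := by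
      rw [← Real.rpow_add (by positivity)]; ring_nf
    have e2 : ‖x‖ ^ (a + (d - r) - finrank ℝ E) = ‖x‖ ^ (a - finrank ℝ E) * ‖x‖ ^ (d - r) := by
      rw [← Real.rpow_add hx']; ring_nf
    have e3 : (1 + ‖u‖) ^ (-(d - r)) * (1 + ‖u‖) ^ (d - r) = 1 := by
      rw [← Real.rpow_add (by positivity)]; simp
    calc (1 + ‖u + x‖) ^ (-d) * ‖x‖ ^ (a - finrank ℝ E)
        = (1 + ‖u + x‖) ^ (-d) * ‖x‖ ^ (a - finrank ℝ E) * (1 + ‖u‖) ^ (-(d - r)) *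
            (1 + ‖u‖) ^ (d - r) := by rw [mul_assoc _ ((1 + ‖u‖) ^ (-(d - r))), e3, mul_one]
      _ ≤ (1 + ‖u + x‖) ^ (-d) * ‖x‖ ^ (a - finrank ℝ E) * (1 + ‖u‖) ^ (-(d - r)) *
            (2 ^ (d - r) * ((1 + ‖u + x‖) ^ (d - r) + ‖x‖ ^ (d - r))) := by gcongr
      _ = _ := by rw [e1, e2]; ring
  calc _ ≤ ∫⁻ x : E, ENNReal.ofReal (2 ^ (d - r) * (1 + ‖u‖) ^ (-(d - r))) *
        (ENNReal.ofReal ((1 + ‖u + x‖) ^ (-r) * ‖x‖ ^ (a - finrank ℝ E)) +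
          ENNReal.ofReal ((1 + ‖u + x‖) ^ (-d) * ‖x‖ ^ (a + (d - r) - finrank ℝ E))) := by
        refine lintegral_mono_ae ?_
        filter_upwards [Measure.ae_ne volume (0 : E)] with x hx
        rw [← ENNReal.ofReal_add (by positivity) (by positivity),
          ← ENNReal.ofReal_mul (by positivity)]
        exact ENNReal.ofReal_le_ofReal (key x hx)
    _ ≤ ENNReal.ofReal (2 ^ (d - r) * (1 + ‖u‖) ^ (-(d - r))) *
        (ENNReal.ofReal C₁ + ENNReal.ofReal C₂) := by
        rw [lintegral_const_mul _ (by fun_prop), lintegral_add_left (by fun_prop)]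
        gcongr
        · exact h₁ u
        · exact h₂ u
    _ = _ := by
        rw [← ENNReal.ofReal_add hC₁ hC₂, ← ENNReal.ofReal_mul (by positivity)]
        ring_nf

/-- Integrating out the arguments of `∏ h (x i)` against a polynomially decaying function of the
sum costs at most `r` powers of decay for every variable. -/
lemma exists_lintegral_pi_one_add_norm_sum_le {h : E → ℝ} (hmeas : Measurable h)
    (hnn : ∀ x, 0 ≤ h x) {r D : ℝ}
    (hdecay : ∀ d, r ≤ d → d ≤ D → ∃ C : ℝ, 0 ≤ C ∧ ∀ u : E,
      ∫⁻ x : E, ENNReal.ofReal ((1 + ‖u + x‖) ^ (-d) * h x) ≤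
        ENNReal.ofReal (C * (1 + ‖u‖) ^ (-(d - r))))
    (k : ℕ) : ∀ d, k * r ≤ d → d ≤ D → 0 ≤ r → ∃ C : ℝ, 0 ≤ C ∧ ∀ u : E,
      ∫⁻ x : Fin k → E, ENNReal.ofReal ((1 + ‖u + ∑ i, x i‖) ^ (-d) * ∏ i, h (x i)) ≤
        ENNReal.ofReal (C * (1 + ‖u‖) ^ (-(d - k * r))) := by
  induction k with
  | zero =>
    intro d _ _ _
    refine ⟨1, zero_le_one, fun u => ?_⟩
    simp [volume_pi]
  | succ k ih =>
    intro d hd hD hr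
    push_cast at hd
    obtain ⟨C₁, hC₁, h₁⟩ := ih d (by linarith) hD hr
    have hkr : 0 ≤ k * r := by positivity
    obtain ⟨C₂, hC₂, h₂⟩ := hdecay (d - k * r) (by linarith) (by linarith)
    refine ⟨C₁ * C₂, by positivity, fun u => ?_⟩
    have hmp := volume_preserving_piFinSuccAbove (fun _ : Fin (k + 1) => E) 0
    rw [← hmp.symm.lintegral_comp_emb (MeasurableEquiv.measurableEmbedding _),
      Measure.volume_eq_prod, lintegral_prod _ (by fun_prop)]
    calc _ = ∫⁻ y : E, ENNReal.ofReal (h y) * ∫⁻ z : Fin k → E,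
          ENNReal.ofReal ((1 + ‖(u + y) + ∑ i, z i‖) ^ (-d) * ∏ i, h (z i)) := by
          refine lintegral_congr fun y => ?_
          rw [← lintegral_const_mul _ (by fun_prop)]
          refine lintegral_congr fun z => ?_
          rw [← ENNReal.ofReal_mul (hnn y)]
          simp [Fin.sum_univ_succ, Fin.prod_univ_succ, add_assoc, Fin.insertNthEquiv]
          ring_nf
      _ ≤ ∫⁻ y : E, ENNReal.ofReal C₁ *
          ENNReal.ofReal ((1 + ‖u + y‖) ^ (-(d - k * r)) * h y) := by
          refine lintegral_mono fun y => ?_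
          rw [← ENNReal.ofReal_mul hC₁, mul_comm _ (h y), mul_left_comm, ENNReal.ofReal_mul (hnn y)]
          gcongr
          exact h₁ _
      _ ≤ ENNReal.ofReal C₁ * ENNReal.ofReal (C₂ * (1 + ‖u‖) ^ (-(d - k * r - r))) := by
          rw [lintegral_const_mul _ (by fun_prop)]
          gcongr
          exact h₂ u
      _ = _ := by
          rw [← ENNReal.ofReal_mul hC₁]
          push_cast
          ring_nf

lemma integrable_one_add_norm_sum_mul_prod [Nontrivial E] {a b r : ℝ} (ha : 0 < a) (hb : 0 < b)
    (har : a < r) (hbr : b < r) {m : ℕ} (hm : m * r ≤ finrank ℝ E) :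
    Integrable (fun x : Fin m → E => (1 + ‖∑ i, x i‖) ^ (-(m * r)) *
      ∏ i, (‖x i‖ ^ (a - finrank ℝ E) + ‖x i‖ ^ (b - finrank ℝ E))) := by
  refine ⟨Measurable.aestronglyMeasurable (by fun_prop), ?_⟩
  rw [hasFiniteIntegral_iff_ofReal (Eventually.of_forall fun x => by positivity)]
  obtain ⟨C, -, hC⟩ := exists_lintegral_pi_one_add_norm_sum_le (E := E)
    (h := fun x => ‖x‖ ^ (a - finrank ℝ E) + ‖x‖ ^ (b - finrank ℝ E)) (by fun_prop)
    (fun x => by positivity) (r := r) (D := finrank ℝ E) (fun d hd hD => by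
      obtain ⟨C₁, hC₁, h₁⟩ := exists_lintegral_one_add_norm_mul_norm_rpow_decay (E := E)
        ha har hd hD
      obtain ⟨C₂, hC₂, h₂⟩ := exists_lintegral_one_add_norm_mul_norm_rpow_decay (E := E)
        hb hbr hd hD
      refine ⟨C₁ + C₂, by positivity, fun u => ?_⟩
      rw [add_mul, ENNReal.ofReal_add (by positivity) (by positivity)]
      refine le_trans (le_of_eq ?_) (add_le_add (h₁ u) (h₂ u))
      rw [← lintegral_add_left (by fun_prop)]
      refine lintegral_congr fun x => ?_
      rw [← ENNReal.ofReal_add (by positivity) (by positivity), mul_add])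
    m (m * r) le_rfl hm (by linarith)
  refine lt_of_le_of_lt ?_ (lt_of_le_of_lt (hC 0) ENNReal.ofReal_lt_top)
  simp

lemma exists_le_norm_rpow_neg_finrank_of_decreasing [Nontrivial E] {f : E → ℝ}
    (hnn : ∀ x, 0 ≤ f x) (hint : Integrable f) {R : ℝ} (hR : 0 < R)
    (hdecr : ∀ x y : E, R < ‖x‖ → ‖x‖ ≤ ‖y‖ → f y ≤ f x)
    (hcont : ∀ x : E, x ≠ 0 → ContinuousAt f x) {r : ℝ} (hr : 0 < r) :
    ∃ C : ℝ, 0 ≤ C ∧ ∀ x : E, r ≤ ‖x‖ → f x ≤ C * ‖x‖ ^ (-(finrank ℝ E : ℝ)) := by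
  set d := finrank ℝ E with hd
  have hcomp : IsCompact (Metric.closedBall (0 : E) (2 * R) \ Metric.ball 0 r) :=
    (isCompact_closedBall _ _).diff Metric.isOpen_ball
  obtain ⟨B, hB⟩ := hcomp.bddAbove_image (f := f) (fun x hx => by
    refine (hcont x ?_).continuousWithinAt
    rintro rfl
    exact hx.2 (by simpa using hr))
  set v : ℝ := volume.real (Metric.ball (0 : E) 1) with hv
  have hvpos : 0 < v := ENNReal.toReal_pos (Metric.measure_ball_pos _ _ one_pos).ne'
    measure_ball_lt_top.ne
  have hI : 0 ≤ ∫ x, f x := integral_nonneg hnn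
  refine ⟨max B 0 * (2 * R) ^ d + 4 ^ d / v * ∫ x, f x, by positivity, fun x hx => ?_⟩
  have hx0 : 0 < ‖x‖ := hr.trans_le hx
  rw [Real.rpow_neg hx0.le, Real.rpow_natCast, ← div_eq_mul_inv, le_div_iff₀ (by positivity)]
  rcases le_or_gt ‖x‖ (2 * R) with h | h
  · have h1 : f x ≤ max B 0 := (hB ⟨x, ⟨by simpa using h, by simpa using hx⟩, rfl⟩).trans
      (le_max_left _ _)
    have h2 : f x * ‖x‖ ^ d ≤ max B 0 * (2 * R) ^ d := by
      gcongr
    have : 0 ≤ 4 ^ d / v * ∫ x, f x := by positivity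
    linarith
  · have hsub : ∀ y ∈ Metric.ball ((3 / 4 : ℝ) • x) (‖x‖ / 4), f x ≤ f y := by
      intro y hy
      rw [Metric.mem_ball, dist_eq_norm] at hy
      have e : ‖(3 / 4 : ℝ) • x‖ = 3 / 4 * ‖x‖ := by rw [norm_smul]; norm_num
      have h1 : ‖y‖ ≤ ‖y - (3 / 4 : ℝ) • x‖ + ‖(3 / 4 : ℝ) • x‖ := by
        simpa using norm_add_le (y - (3 / 4 : ℝ) • x) ((3 / 4 : ℝ) • x)
      have h2 : ‖(3 / 4 : ℝ) • x‖ ≤ ‖y - (3 / 4 : ℝ) • x‖ + ‖y‖ := by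
        rw [← norm_neg (y - _)]
        simpa using norm_add_le (-(y - (3 / 4 : ℝ) • x)) y
      rw [e] at h1 h2
      exact hdecr y x (by linarith) (by linarith)
    have h1 : f x * volume.real (Metric.ball ((3 / 4 : ℝ) • x) (‖x‖ / 4)) ≤ ∫ y, f y := by
      calc _ = ∫ y in Metric.ball ((3 / 4 : ℝ) • x) (‖x‖ / 4), f x := by
            rw [setIntegral_const, smul_eq_mul, mul_comm]
        _ ≤ ∫ y in Metric.ball ((3 / 4 : ℝ) • x) (‖x‖ / 4), f y :=
          setIntegral_mono_on (integrableOn_const measure_ball_lt_top.ne) hint.integrableOn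
            measurableSet_ball hsub
        _ ≤ _ := setIntegral_le_integral hint (Eventually.of_forall hnn)
    have h2 : volume.real (Metric.ball ((3 / 4 : ℝ) • x) (‖x‖ / 4)) = (‖x‖ / 4) ^ d * v := by
      rw [measureReal_def, Measure.addHaar_ball _ _ (by positivity), ENNReal.toReal_mul,
        ENNReal.toReal_ofReal (by positivity)]
      rfl
    rw [h2, div_pow] at h1
    have h3 : f x * ‖x‖ ^ d ≤ 4 ^ d / v * ∫ x, f x := by
      calc f x * ‖x‖ ^ d = 4 ^ d / v * (f x * (‖x‖ ^ d / 4 ^ d * v)) := by field_simp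
        _ ≤ _ := by gcongr
    have : 0 ≤ max B 0 * (2 * R) ^ d := by positivity
    linarith

end

/-- The L² kernel convergence (7.15)–(7.17) in the proof of Theorem 1, part (2):
the micro-rescaled multiple Wiener–Itô kernels `M_ε` converge in `L²(ℝ^{nm})` to
the limiting singular kernel `M₀`. -/
theorem micro_scaling_kernel_L2_convergence
    (n m : ℕ) (hn : 1 ≤ n) (hm : 1 ≤ m)
    (μ α γ χ t κ : ℝ) (hμ : 0 < μ) (hα : 0 < α) (hγ : 0 ≤ γ) (hχ : 0 < χ)
    (ht : 0 < t) (hκ0 : 0 < κ) (hκn : (m : ℝ) * κ < n)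
    (L : ℝ → ℝ) (hLpos : ∀ y > 0, 0 < L y) (hL : SlowlyVaryingAtTop L)
    (hLbdd : ∀ M > 0, ∃ Cb, ∀ y ∈ Set.Ioc (0:ℝ) M, L y ≤ Cb)
    (f : EuclideanSpace ℝ (Fin n) → ℝ)
    (hfmeas : Measurable f) (hfnonneg : ∀ l, 0 ≤ f l) (hfint : Integrable f)
    (lam0 : ℝ) (hlam0 : 0 < lam0)
    (hfdecr : ∀ l l' : EuclideanSpace ℝ (Fin n), lam0 < ‖l‖ → ‖l‖ ≤ ‖l'‖ → f l' ≤ f l)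
    (hfcont : ∀ l : EuclideanSpace ℝ (Fin n), l ≠ 0 → ContinuousAt f l)
    (hfasymp : Tendsto
      (fun l : EuclideanSpace ℝ (Fin n) =>
        f l * ‖l‖ ^ ((n : ℝ) - κ) / (tauberK n κ * L (1 / ‖l‖)))
      (𝓝[≠] (0 : EuclideanSpace ℝ (Fin n))) (𝓝 1))
    (Mε : ℝ → (Fin m → EuclideanSpace ℝ (Fin n)) → ℝ)
    (hMε : ∀ ε l, Mε ε l =
      ε ^ (χ * (m : ℝ) * ((n : ℝ) - κ) / 2) * L (ε ^ (-χ)) ^ (-(m : ℝ) / 2) *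
        Real.exp (-(μ * t * (ε ^ (2 / (α + γ)) + ‖∑ σ, l σ‖ ^ 2) ^ (γ / 2) *
          ‖∑ σ, l σ‖ ^ α)) *
        ∏ σ, Real.sqrt (f ((ε ^ χ) • l σ)))
    (M₀ : (Fin m → EuclideanSpace ℝ (Fin n)) → ℝ)
    (hM₀ : ∀ l, M₀ l =
      tauberK n κ ^ ((m : ℝ) / 2) * Real.exp (-(μ * t * ‖∑ σ, l σ‖ ^ (α + γ))) *
        ∏ σ, ‖l σ‖ ^ ((κ - (n : ℝ)) / 2)) :
    Tendsto (fun ε : ℝ =>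
        ∫ l : Fin m → EuclideanSpace ℝ (Fin n), (Mε ε l - M₀ l) ^ 2)
      (𝓝[>] 0) (𝓝 0) := by
  have : Nonempty (Fin n) := ⟨⟨0, hn⟩⟩
  have hfin : Module.finrank ℝ (EuclideanSpace ℝ (Fin n)) = n := finrank_euclideanSpace_fin
  have hm1 : (1 : ℝ) ≤ m := by exact_mod_cast hm
  have hm0 : (0 : ℝ) < m := by linarith
  have hκn' : κ < n := by nlinarith
  have hK := tauberK_pos hκ0 hκn'
  set K := tauberK n κ
  set r : ℝ := n / m with hr
  have hmr : m * r = n := mul_div_cancel₀ _ hm0.ne'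
  have hκr : κ < r := by rw [hr, lt_div_iff₀ hm0]; linarith
  set η : ℝ := min (κ / 2) ((r - κ) / 2) with hη
  have hη0 : 0 < η := lt_min (by linarith) (by linarith)
  have hη1 : η ≤ κ / 2 := min_le_left _ _
  have hη2 : η ≤ (r - κ) / 2 := min_le_right _ _
  have htail : ∀ ρ > 0, ∃ C : ℝ, 0 ≤ C ∧ ∀ x : EuclideanSpace ℝ (Fin n),
      ρ ≤ ‖x‖ → f x ≤ C * ‖x‖ ^ (-(n : ℝ)) := by
    intro ρ hρ
    have := exists_le_norm_rpow_neg_finrank_of_decreasing hfnonneg hfint hlam0 hfdecr hfcont hρ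
    rwa [hfin] at this
  obtain ⟨C, hC, hdom⟩ := exists_rescaled_density_le hL hLpos hK hκ0.le hη0 htail hfasymp
  obtain ⟨D, hD, hexp⟩ := exists_exp_neg_mul_rpow_le (c := 2 * (μ * t)) (p := α + γ) (d := m * r)
    (by positivity) (by linarith) (by rw [hmr]; linarith)
  have hint := integrable_one_add_norm_sum_mul_prod (E := EuclideanSpace ℝ (Fin n))
    (a := κ - η) (b := κ + η) (r := r)
    (by linarith) (by linarith) (by linarith) (by linarith) (m := m) (by rw [hmr, hfin])
  rw [hfin] at hint
  set g : ℝ → EuclideanSpace ℝ (Fin n) → ℝ :=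
    fun δ x => δ ^ ((n : ℝ) - κ) * f (δ • x) / L δ⁻¹ with hg
  have hδ : Tendsto (fun ε : ℝ => ε ^ χ) (𝓝[>] 0) (𝓝[>] 0) := by
    refine tendsto_nhdsWithin_iff.2 ⟨?_, ?_⟩
    · have : Tendsto (fun ε : ℝ => ε ^ χ) (𝓝 0) (𝓝 ((0 : ℝ) ^ χ)) :=
        tendsto_id.rpow_const (Or.inr hχ.le)
      rw [Real.zero_rpow hχ.ne'] at this
      exact this.mono_left nhdsWithin_le_nhds
    · filter_upwards [self_mem_nhdsWithin] with ε hε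
      exact Real.rpow_pos_of_pos hε _
  have hgnn : ∀ ε > 0, ∀ x, 0 ≤ g (ε ^ χ) x := by
    intro ε hε x
    have h1 := hfnonneg ((ε ^ χ) • x)
    have h2 := hLpos (ε ^ χ)⁻¹ (by positivity)
    have h3 : 0 < ε ^ χ := by positivity
    positivity
  have hMg : ∀ ε > 0, ∀ l, Mε ε l =
      Real.exp (-(μ * t * (ε ^ (2 / (α + γ)) + ‖∑ σ, l σ‖ ^ 2) ^ (γ / 2) * ‖∑ σ, l σ‖ ^ α)) *
        ∏ σ, √(g (ε ^ χ) (l σ)) := by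
    intro ε hε l
    have hLε := hLpos (ε ^ (-χ)) (by positivity)
    have e1 : ∀ x, √(g (ε ^ χ) x) =
        (ε ^ (χ * ((n : ℝ) - κ) / 2) * L (ε ^ (-χ)) ^ (-(1 / 2) : ℝ)) * √(f ((ε ^ χ) • x)) := by
      intro x
      simp only [hg]
      rw [← Real.rpow_mul hε.le, ← Real.rpow_neg hε.le, Real.sqrt_div' _ hLε.le,
        Real.sqrt_mul (by positivity), Real.sqrt_eq_rpow (ε ^ _), Real.sqrt_eq_rpow (L _),
        ← Real.rpow_mul hε.le, Real.rpow_neg hLε.le]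
      ring_nf
    rw [hMε, Finset.prod_congr rfl fun σ _ => e1 (l σ), Finset.prod_mul_distrib]
    simp only [Finset.prod_const, Finset.card_univ, Fintype.card_fin]
    rw [mul_pow, ← Real.rpow_natCast (ε ^ _), ← Real.rpow_natCast (L _ ^ _),
      ← Real.rpow_mul hε.le, ← Real.rpow_mul hLε.le]
    ring_nf
  have hM₀g : ∀ l, M₀ l = Real.exp (-(μ * t * ‖∑ σ, l σ‖ ^ (α + γ))) *
        ∏ σ, √(K * ‖l σ‖ ^ (κ - n)) := by
    intro l
    have e1 : ∀ x : EuclideanSpace ℝ (Fin n),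
        √(K * ‖x‖ ^ (κ - n)) = K ^ (1 / 2 : ℝ) * ‖x‖ ^ ((κ - n) / 2) := by
      intro x
      rw [Real.sqrt_mul hK.le, Real.sqrt_eq_rpow, Real.sqrt_eq_rpow,
        ← Real.rpow_mul (norm_nonneg _)]
      ring_nf
    rw [hM₀, Finset.prod_congr rfl fun σ _ => e1 (l σ), Finset.prod_mul_distrib]
    simp only [Finset.prod_const, Finset.card_univ, Fintype.card_fin]
    rw [← Real.rpow_natCast (K ^ _), ← Real.rpow_mul hK.le]
    ring_nf
  have hlim : ∀ l : Fin m → EuclideanSpace ℝ (Fin n), (∀ σ, l σ ≠ 0) →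
      Tendsto (fun ε => Mε ε l) (𝓝[>] 0) (𝓝 (M₀ l)) := by
    intro l hl
    rw [hM₀g]
    have hp : Tendsto (fun ε : ℝ => ∏ σ, √(g (ε ^ χ) (l σ))) (𝓝[>] 0)
        (𝓝 (∏ σ, √(K * ‖l σ‖ ^ (κ - n)))) :=
      tendsto_finsetProd _ fun σ _ =>
        ((tendsto_rescaled_density hL hLpos hK hfasymp (hl σ)).comp hδ).sqrt
    have hb : Tendsto (fun ε : ℝ => (ε ^ (2 / (α + γ)) + ‖∑ σ, l σ‖ ^ 2) ^ (γ / 2)) (𝓝[>] 0)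
        (𝓝 (‖∑ σ, l σ‖ ^ γ)) := by
      have h0 : Tendsto (fun ε : ℝ => ε ^ (2 / (α + γ))) (𝓝 0)
          (𝓝 ((0 : ℝ) ^ (2 / (α + γ)))) := tendsto_id.rpow_const (Or.inr (by positivity))
      rw [Real.zero_rpow (by positivity)] at h0
      have h1 := ((h0.mono_left (nhdsWithin_le_nhds (s := Set.Ioi 0))).add_const
        (‖∑ σ, l σ‖ ^ 2)).rpow_const (p := γ / 2) (Or.inr (by positivity))
      rwa [zero_add, sq_rpow_half (norm_nonneg _)] at h1
    have he := (((hb.const_mul (μ * t)).mul_const (‖∑ σ, l σ‖ ^ α)).neg.rexp).mul hp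
    have e : μ * t * ‖∑ σ, l σ‖ ^ (α + γ) = μ * t * ‖∑ σ, l σ‖ ^ γ * ‖∑ σ, l σ‖ ^ α := by
      rw [Real.rpow_add_of_nonneg (norm_nonneg _) hα.le hγ]
      ring
    rw [e]
    refine he.congr' ?_
    filter_upwards [self_mem_nhdsWithin] with ε hε
    exact (hMg ε hε l).symm
  set B : (Fin m → EuclideanSpace ℝ (Fin n)) → ℝ := fun l =>
    D * C ^ m * ((1 + ‖∑ σ, l σ‖) ^ (-(m * r)) *
    ∏ σ, (‖l σ‖ ^ (κ - η - n) + ‖l σ‖ ^ (κ + η - n))) with hB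
  have hbound : ∀ᶠ ε in 𝓝[>] (0 : ℝ), ∀ l : Fin m → EuclideanSpace ℝ (Fin n),
      (∀ σ, l σ ≠ 0) → Mε ε l ^ 2 ≤ B l := by
    filter_upwards [self_mem_nhdsWithin, hδ.eventually hdom] with ε hε hε' l hl
    have hε0 : (0 : ℝ) < ε := hε
    have h1 : ∏ σ, g (ε ^ χ) (l σ) ≤
        ∏ σ, C * (‖l σ‖ ^ (κ - η - n) + ‖l σ‖ ^ (κ + η - n)) :=
      Finset.prod_le_prod (fun σ _ => hgnn ε hε _) fun σ _ => hε' (l σ) (hl σ)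
    rw [Finset.prod_mul_distrib] at h1
    simp only [Finset.prod_const, Finset.card_univ, Fintype.card_fin] at h1
    set S := ‖∑ σ, l σ‖
    have hS : 0 ≤ S := norm_nonneg _
    have h2 : S ^ γ ≤ (ε ^ (2 / (α + γ)) + S ^ 2) ^ (γ / 2) := by
      rw [← sq_rpow_half hS]
      gcongr
      linarith [Real.rpow_nonneg hε0.le (2 / (α + γ))]
    have h3 : Real.exp (-(μ * t * (ε ^ (2 / (α + γ)) + S ^ 2) ^ (γ / 2) * S ^ α)) ^ 2 ≤
        D * (1 + S) ^ (-(m * r)) := by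
      refine le_trans ?_ (hexp S hS)
      rw [← Real.exp_nat_mul]
      refine Real.exp_le_exp.2 ?_
      rw [Real.rpow_add_of_nonneg hS hα.le hγ]
      have h4 : μ * t * S ^ α * S ^ γ ≤
          μ * t * S ^ α * (ε ^ (2 / (α + γ)) + S ^ 2) ^ (γ / 2) := by gcongr
      push_cast
      linarith
    calc Mε ε l ^ 2 = Real.exp (-(μ * t * (ε ^ (2 / (α + γ)) + S ^ 2) ^ (γ / 2) * S ^ α)) ^ 2 *
          ∏ σ, g (ε ^ χ) (l σ) := by
          rw [hMg ε hε, mul_pow, ← Finset.prod_pow]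
          congr 1
          exact Finset.prod_congr rfl fun σ _ => Real.sq_sqrt (hgnn ε hε _)
      _ ≤ (D * (1 + S) ^ (-(m * r))) *
          (C ^ m * ∏ σ, (‖l σ‖ ^ (κ - η - n) + ‖l σ‖ ^ (κ + η - n))) :=
          mul_le_mul h3 h1 (Finset.prod_nonneg fun σ _ => hgnn ε hε _) (by positivity)
      _ = B l := by simp only [hB]; ring
  have hbound₀ : ∀ l : Fin m → EuclideanSpace ℝ (Fin n), (∀ σ, l σ ≠ 0) → M₀ l ^ 2 ≤ B l :=
    fun l hl => le_of_tendsto ((hlim l hl).pow 2) (hbound.mono fun ε h => h l hl)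
  have hae : ∀ᵐ l : Fin m → EuclideanSpace ℝ (Fin n), ∀ σ, l σ ≠ 0 := ae_all_iff.2 fun σ =>
    (Measure.quasiMeasurePreserving_eval (fun _ : Fin m => volume) σ).ae (Measure.ae_ne volume 0)
  have hMmeas : ∀ ε, Measurable (Mε ε) := by
    intro ε
    rw [funext (hMε ε)]
    fun_prop
  have hM₀meas : Measurable M₀ := by
    rw [funext hM₀]
    fun_prop
  have := tendsto_integral_filter_of_dominated_convergence (μ := volume) (l := 𝓝[>] (0 : ℝ))
    (F := fun ε l => (Mε ε l - M₀ l) ^ 2) (f := fun _ => 0) (fun l => 4 * B l)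
    (Eventually.of_forall fun ε => (((hMmeas ε).sub hM₀meas).pow_const 2).aestronglyMeasurable)
    (by
      filter_upwards [hbound] with ε hε
      filter_upwards [hae] with l hl
      rw [Real.norm_of_nonneg (sq_nonneg _)]
      nlinarith [hε l hl, hbound₀ l hl, sq_nonneg (Mε ε l + M₀ l)])
    ((hint.const_mul _).const_mul 4)
    (by
      filter_upwards [hae] with l hl
      simpa using ((hlim l hl).sub_const (M₀ l)).pow 2)
  simpa using this
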